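/- Let r be a standard Gaussian random vector on ℝ^n (mean zero, identity covariance), and let v, w ∈ ℝ^n be unit vectors. Then E[ sign(v^⊤ r) · sign(w^⊤ r) ] = 1 − (2/π) · arccos(v^⊤ w). -/

import Mathlib

open Matrix MeasureTheory ProbabilityTheory

/-- Euclidean norm of a finitely indexed real vector. -/
noncomputable def euclNorm {ι : Type} [Fintype ι] (v : ι → ℝ) : ℝ :=
  Real.sqrt (∑ i, (v i) ^ 2)

lemma gi_charFun {m : ℕ} (u : Fin m → ℝ) :
    ∫ x : Fin m → ℝ, Complex.exp (((u ⬝ᵥ x : ℝ) : ℂ) * Complex.I)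
        ∂(Measure.pi fun _ : Fin m => gaussianReal 0 1)
      = Complex.exp (-((u ⬝ᵥ u : ℝ) : ℂ) / 2) := by
  have h := charFun_stdGaussian (E := EuclideanSpace ℝ (Fin m)) (WithLp.toLp 2 u)
  rw [← map_pi_eq_stdGaussian, charFun_apply, integral_map (by fun_prop) (by fun_prop)] at h
  have h2 : ‖(WithLp.toLp 2 u : EuclideanSpace ℝ (Fin m))‖ ^ 2 = u ⬝ᵥ u := by
    rw [EuclideanSpace.real_norm_sq_eq]
    simp [dotProduct, sq]
  rw [← h2]
  push_cast
  rw [← h]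
  congr 1

lemma gi_map_eq {m n : ℕ} (v w : Fin n → ℝ) (p q : Fin m → ℝ)
    (h1 : v ⬝ᵥ v = p ⬝ᵥ p) (h2 : v ⬝ᵥ w = p ⬝ᵥ q) (h3 : w ⬝ᵥ w = q ⬝ᵥ q) :
    (Measure.pi fun _ : Fin n => gaussianReal 0 1).map (fun x => (v ⬝ᵥ x, w ⬝ᵥ x))
      = (Measure.pi fun _ : Fin m => gaussianReal 0 1).map (fun x => (p ⬝ᵥ x, q ⬝ᵥ x)) := by
  have meas : ∀ {k : ℕ} (a b : Fin k → ℝ),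
      Measurable (fun x : Fin k → ℝ => (a ⬝ᵥ x, b ⬝ᵥ x)) := by
    intro k a b
    unfold dotProduct
    fun_prop
  have key : ∀ {k : ℕ} (a b : Fin k → ℝ) (L : StrongDual ℝ (ℝ × ℝ)),
      charFunDual ((Measure.pi fun _ : Fin k => gaussianReal 0 1).map
        (fun x => (a ⬝ᵥ x, b ⬝ᵥ x))) L
      = Complex.exp (-((L (1, 0) ^ 2 * (a ⬝ᵥ a) + 2 * L (1, 0) * L (0, 1) * (a ⬝ᵥ b)
          + L (0, 1) ^ 2 * (b ⬝ᵥ b) : ℝ) : ℂ) / 2) := by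
    intro k a b L
    rw [charFunDual_apply, integral_map (meas a b).aemeasurable (by fun_prop)]
    have hL : ∀ s t : ℝ, L (s, t) = L (1, 0) * s + L (0, 1) * t := by
      intro s t
      have : ((s, t) : ℝ × ℝ) = s • (1, 0) + t • (0, 1) := by simp
      rw [this, map_add, map_smul, map_smul]
      simp [mul_comm]
    have := gi_charFun (L (1, 0) • a + L (0, 1) • b)
    convert this using 5 with x
    · rw [hL]
      simp [add_dotProduct, smul_dotProduct]
    · simp only [add_dotProduct, smul_dotProduct, dotProduct_add, dotProduct_smul, smul_eq_mul]
      rw [dotProduct_comm b a]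
      ring
  have i1 : IsProbabilityMeasure ((Measure.pi fun _ : Fin n => gaussianReal 0 1).map
        (fun x => (v ⬝ᵥ x, w ⬝ᵥ x))) := Measure.isProbabilityMeasure_map (meas v w).aemeasurable
  have i2 : IsProbabilityMeasure ((Measure.pi fun _ : Fin m => gaussianReal 0 1).map
        (fun x => (p ⬝ᵥ x, q ⬝ᵥ x))) := Measure.isProbabilityMeasure_map (meas p q).aemeasurable
  apply Measure.ext_of_charFunDual
  ext L
  rw [key, key, h1, h2, h3]

lemma gi_measurable_sign : Measurable Real.sign := by
  unfold Real.sign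
  exact Measurable.ite measurableSet_Iio measurable_const
    (Measurable.ite measurableSet_Ioi measurable_const measurable_const)

lemma gi_sign_mul {r : ℝ} (hr : 0 < r) (x : ℝ) : Real.sign (r * x) = Real.sign x := by
  rcases lt_trichotomy x 0 with h | h | h
  · rw [Real.sign_of_neg h, Real.sign_of_neg (mul_neg_of_pos_of_neg hr h)]
  · simp [h]
  · rw [Real.sign_of_pos h, Real.sign_of_pos (mul_pos hr h)]

lemma gi_radial : ∫ r in Set.Ioi (0 : ℝ), r * Real.exp (-r ^ 2 / 2) = 1 := by
  have h := integral_mul_cexp_neg_mul_sq (b := (1 / 2 : ℂ)) (by norm_num)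
  have h2 : ∀ r : ℝ, (r : ℂ) * Complex.exp (-(1 / 2) * (r : ℂ) ^ 2)
      = ((r * Real.exp (-r ^ 2 / 2) : ℝ) : ℂ) := by
    intro r
    push_cast
    congr 2
    ring
  simp_rw [h2] at h
  rw [integral_complex_ofReal] at h
  norm_num at h
  exact_mod_cast h

lemma gi_angular (θ : ℝ) (h0 : 0 ≤ θ) (h1 : θ ≤ Real.pi) :
    ∫ φ in Set.Ioo (-Real.pi) Real.pi, Real.sign (Real.cos φ) * Real.sign (Real.cos (φ - θ))
      = 2 * (Real.pi - 2 * θ) := by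
  have hpi := Real.pi_pos
  set h : ℝ → ℝ := fun φ => Real.sign (Real.cos φ) * Real.sign (Real.cos (φ - θ)) with hh
  have hmeas : Measurable h :=
    (gi_measurable_sign.comp Real.measurable_cos).mul
      (gi_measurable_sign.comp (Real.measurable_cos.comp (measurable_id.sub_const θ)))
  have hb : ∀ x, ‖h x‖ ≤ 1 := by
    intro x
    rcases Real.sign_apply_eq (Real.cos x) with a | a | a <;>
    rcases Real.sign_apply_eq (Real.cos (x - θ)) with b | b | b <;> simp [hh, a, b]
  have hInt : ∀ a b : ℝ, IntervalIntegrable h volume a b := by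
    intro a b
    refine (intervalIntegrable_const (c := (1 : ℝ))).mono_fun hmeas.aestronglyMeasurable ?_
    exact Filter.Eventually.of_forall fun x => by simpa using hb x
  have hper : Function.Periodic h Real.pi := by
    intro x
    have : x + Real.pi - θ = (x - θ) + Real.pi := by ring
    simp only [hh, this, Real.cos_add_pi, Real.sign_neg]
    ring
  rw [← integral_Ioc_eq_integral_Ioo, ← intervalIntegral.integral_of_le (by linarith)]
  change ∫ φ in (-Real.pi)..Real.pi, h φ = _
  rw [← intervalIntegral.integral_add_adjacent_intervals (hInt (-Real.pi) 0) (hInt 0 Real.pi)]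
  have e1 := hper.intervalIntegral_add_eq (-Real.pi) (-(Real.pi / 2))
  have e2 := hper.intervalIntegral_add_eq 0 (-(Real.pi / 2))
  rw [show -Real.pi + Real.pi = 0 by ring] at e1
  rw [zero_add] at e2
  rw [e1, e2, ← intervalIntegral.integral_add_adjacent_intervals
    (hInt (-(Real.pi / 2)) (θ - Real.pi / 2)) (hInt (θ - Real.pi / 2) _)]
  have f1 : ∫ φ in (-(Real.pi / 2))..(θ - Real.pi / 2), h φ
      = ∫ φ in (-(Real.pi / 2))..(θ - Real.pi / 2), (-1 : ℝ) := by
    rw [intervalIntegral.integral_of_le (by linarith), intervalIntegral.integral_of_le (by linarith),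
      integral_Ioc_eq_integral_Ioo, integral_Ioc_eq_integral_Ioo]
    refine setIntegral_congr_fun measurableSet_Ioo fun x hx => ?_
    have c1 : 0 < Real.cos x := Real.cos_pos_of_mem_Ioo ⟨by linarith [hx.1], by linarith [hx.2]⟩
    have c2 : Real.cos (x - θ) < 0 := by
      rw [← Real.cos_neg]
      exact Real.cos_neg_of_pi_div_two_lt_of_lt (by linarith [hx.2]) (by linarith [hx.1])
    simp [hh, Real.sign_of_pos c1, Real.sign_of_neg c2]
  have f2 : ∫ φ in (θ - Real.pi / 2)..(-(Real.pi / 2) + Real.pi), h φ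
      = ∫ φ in (θ - Real.pi / 2)..(-(Real.pi / 2) + Real.pi), (1 : ℝ) := by
    rw [intervalIntegral.integral_of_le (by linarith), intervalIntegral.integral_of_le (by linarith),
      integral_Ioc_eq_integral_Ioo, integral_Ioc_eq_integral_Ioo]
    refine setIntegral_congr_fun measurableSet_Ioo fun x hx => ?_
    have c1 : 0 < Real.cos x := Real.cos_pos_of_mem_Ioo ⟨by linarith [hx.1], by linarith [hx.2]⟩
    have c2 : 0 < Real.cos (x - θ) :=
      Real.cos_pos_of_mem_Ioo ⟨by linarith [hx.1], by linarith [hx.2]⟩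
    simp [hh, Real.sign_of_pos c1, Real.sign_of_pos c2]
  rw [f1, f2, intervalIntegral.integral_const, intervalIntegral.integral_const]
  simp only [smul_eq_mul]
  ring

lemma gi_plane (θ : ℝ) (h0 : 0 ≤ θ) (h1 : θ ≤ Real.pi) :
    ∫ z : ℝ × ℝ, Real.sign z.1 * Real.sign (Real.cos θ * z.1 + Real.sin θ * z.2)
        ∂((gaussianReal 0 1).prod (gaussianReal 0 1))
      = 1 - (2 / Real.pi) * θ := by
  have hpi := Real.pi_pos
  have mg := measurable_gaussianPDF 0 1
  rw [gaussianReal_of_var_ne_zero 0 one_ne_zero, prod_withDensity mg mg,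
    integral_withDensity_eq_integral_toReal_smul (by fun_prop)
      (Filter.Eventually.of_forall fun z =>
        ENNReal.mul_lt_top (by simp [gaussianPDF]) (by simp [gaussianPDF])),
    ← Measure.volume_eq_prod, ← integral_comp_polarCoord_symm]
  have e : ∀ p ∈ polarCoord.target,
      p.1 • (((gaussianPDF 0 1 (polarCoord.symm p).1 * gaussianPDF 0 1 (polarCoord.symm p).2).toReal) •
        (Real.sign (polarCoord.symm p).1 *
          Real.sign (Real.cos θ * (polarCoord.symm p).1 + Real.sin θ * (polarCoord.symm p).2)))
      = (p.1 * Real.exp (-p.1 ^ 2 / 2)) *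
        ((2 * Real.pi)⁻¹ * (Real.sign (Real.cos p.2) * Real.sign (Real.cos (p.2 - θ)))) := by
    rintro ⟨r, φ⟩ hp
    have hr : 0 < r := hp.1
    have s1 : Real.cos θ * (r * Real.cos φ) + Real.sin θ * (r * Real.sin φ)
        = r * Real.cos (φ - θ) := by
      rw [Real.cos_sub]; ring
    simp only [polarCoord_symm_apply, smul_eq_mul, s1, gi_sign_mul hr, ENNReal.toReal_mul,
      toReal_gaussianPDF, gaussianPDFReal]
    have s2 : Real.exp (-r ^ 2 / 2) = Real.exp (-(r * Real.cos φ - 0) ^ 2 / (2 * ((1 : NNReal) : ℝ)))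
        * Real.exp (-(r * Real.sin φ - 0) ^ 2 / (2 * ((1 : NNReal) : ℝ))) := by
      rw [← Real.exp_add]
      congr 1
      have := Real.sin_sq_add_cos_sq φ
      simp only [NNReal.coe_one]
      linear_combination (r ^ 2 / 2) * this
    have s3 : (√(2 * Real.pi * ((1 : NNReal) : ℝ)))⁻¹ * (√(2 * Real.pi * ((1 : NNReal) : ℝ)))⁻¹
        = (2 * Real.pi)⁻¹ := by
      rw [← mul_inv, Real.mul_self_sqrt (by positivity)]
      simp
    rw [s2, ← s3]
    ring
  rw [setIntegral_congr_fun polarCoord.open_target.measurableSet e]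
  rw [polarCoord_target, Measure.volume_eq_prod,
    setIntegral_prod_mul (fun r : ℝ => r * Real.exp (-r ^ 2 / 2))
      (fun φ : ℝ => (2 * Real.pi)⁻¹ * (Real.sign (Real.cos φ) * Real.sign (Real.cos (φ - θ)))),
    gi_radial, integral_const_mul, gi_angular θ h0 h1]
  field_simp

/-- Grothendieck identity: for a standard Gaussian vector `r` on `ℝ^n` and unit
vectors `v, w`, `E[sign(vᵀr) · sign(wᵀr)] = 1 − (2/π) arccos(vᵀw)`. -/
theorem stmt15 (n : ℕ) (v w : Fin n → ℝ)
    (hv : euclNorm v = 1) (hw : euclNorm w = 1) :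
    ∫ x : Fin n → ℝ, Real.sign (v ⬝ᵥ x) * Real.sign (w ⬝ᵥ x)
        ∂(Measure.pi fun _ : Fin n => gaussianReal 0 1)
      = 1 - (2 / Real.pi) * Real.arccos (v ⬝ᵥ w) := by
  have unit : ∀ a : Fin n → ℝ, euclNorm a = 1 → a ⬝ᵥ a = 1 := by
    intro a ha
    unfold euclNorm at ha
    rw [Real.sqrt_eq_one] at ha
    simpa [dotProduct, sq] using ha
  have hv1 := unit v hv
  have hw1 := unit w hw
  have nonneg : ∀ a : Fin n → ℝ, 0 ≤ a ⬝ᵥ a := fun a =>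
    Finset.sum_nonneg fun i _ => mul_self_nonneg (a i)
  have hle : v ⬝ᵥ w ≤ 1 := by
    have := nonneg (v - w)
    simp only [sub_dotProduct, dotProduct_sub, dotProduct_comm w v, hv1, hw1] at this
    linarith
  have hge : -1 ≤ v ⬝ᵥ w := by
    have := nonneg (v + w)
    simp only [add_dotProduct, dotProduct_add, dotProduct_comm w v, hv1, hw1] at this
    linarith
  set θ := Real.arccos (v ⬝ᵥ w) with hθ
  have hcos : Real.cos θ = v ⬝ᵥ w := Real.cos_arccos hge hle
  have hsc := Real.sin_sq_add_cos_sq θ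
  have hmap := gi_map_eq v w ![1, 0] ![Real.cos θ, Real.sin θ] (by simp [hv1])
    (by simp [hcos]) (by simp [hw1]; linarith)
  have ms : Measurable (fun z : ℝ × ℝ => Real.sign z.1 * Real.sign z.2) :=
    (gi_measurable_sign.comp measurable_fst).mul (gi_measurable_sign.comp measurable_snd)
  have meas : ∀ {k : ℕ} (a b : Fin k → ℝ),
      Measurable (fun x : Fin k → ℝ => (a ⬝ᵥ x, b ⬝ᵥ x)) := by
    intro k a b
    unfold dotProduct
    fun_prop
  have step := integral_map (μ := Measure.pi fun _ : Fin n => gaussianReal 0 1)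
    (meas v w).aemeasurable ms.aestronglyMeasurable
  rw [← step, hmap, integral_map (meas _ _).aemeasurable ms.aestronglyMeasurable,
    ← gi_plane θ (Real.arccos_nonneg _) (Real.arccos_le_pi _),
    ← (measurePreserving_finTwoArrow (gaussianReal 0 1)).integral_comp'
      (g := fun z : ℝ × ℝ => Real.sign z.1 * Real.sign (Real.cos θ * z.1 + Real.sin θ * z.2))]
  congr 1
  ext x
  simp [dotProduct, Fin.sum_univ_two, MeasurableEquiv.finTwoArrow]
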